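/- For every integer s ≥ 2 and every real ξ, the characteristic function of the density σ_s is given by the everywhere absolutely convergent series ∫_{−√K}^{√K} e^{iξx} σ_s(x) dx = ∑_{k=0}^∞ (−ξ²)^k · m_k / (2k)!, where m_k = (1/(sk+1)) · binomial((s+1)k, k). -/

import Mathlib

open MeasureTheory Real

noncomputable def eulerBeta (a b : ℝ) : ℝ := Real.Gamma a * Real.Gamma b / Real.Gamma (a + b)

noncomputable def Kc (s : ℕ) : ℝ := ((s : ℝ) + 1) ^ (s + 1) / (s : ℝ) ^ s

noncomputable def tauProd {s : ℕ} (t : Fin s → ℝ) : ℝ := ∏ i, t i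

def cube (s : ℕ) : Set (Fin s → ℝ) := Set.univ.pi fun _ => Set.Icc (0 : ℝ) 1

noncomputable def Cnorm (s : ℕ) : ℝ :=
  1 / (eulerBeta (1 / ((s : ℝ) + 1)) (((s : ℝ) - 1) / (2 * (s : ℝ) + 2)) *
      ∏ j ∈ Finset.Icc 2 s,
        eulerBeta ((j : ℝ) / ((s : ℝ) + 1)) ((j : ℝ) / ((s : ℝ) * ((s : ℝ) + 1))))

noncomputable def Fdens (s : ℕ) (t : Fin s → ℝ) : ℝ :=
  Cnorm s * ∏ i : Fin s,
    if (i : ℕ) = 0 then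
      t i ^ (1 / ((s : ℝ) + 1) - 1) * (1 - t i) ^ (((s : ℝ) - 1) / (2 * (s : ℝ) + 2) - 1)
    else
      t i ^ ((((i : ℕ) : ℝ) + 1) / ((s : ℝ) + 1) - 1) *
        (1 - t i) ^ ((((i : ℕ) : ℝ) + 1) / ((s : ℝ) * ((s : ℝ) + 1)) - 1)

noncomputable def sigmaDens (s : ℕ) (x : ℝ) : ℝ :=
  (1 / eulerBeta (1 / 2) (1 / 2 + 1 / (s : ℝ))) *
    ∫ t in cube s,
      if x ^ 2 ≤ tauProd t * Kc s then
        (tauProd t * Kc s - x ^ 2) ^ (1 / (s : ℝ) - 1 / 2) *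
          (tauProd t * Kc s) ^ (-(1 : ℝ) / (s : ℝ)) * Fdens s t
      else 0


lemma eulerBeta_pos' {a b : ℝ} (ha : 0 < a) (hb : 0 < b) : 0 < eulerBeta a b :=
  ProbabilityTheory.beta_pos ha hb

lemma beta_int {a b : ℝ} (ha : 0 < a) (hb : 0 < b) :
    ∫ x in Set.Icc (0 : ℝ) 1, x ^ (a - 1) * (1 - x) ^ (b - 1) = eulerBeta a b := by
  have h := ProbabilityTheory.beta_eq_betaIntegralReal a b ha hb
  rw [show eulerBeta a b = ProbabilityTheory.beta a b from rfl, h, Complex.betaIntegral,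
    intervalIntegral.integral_of_le (by norm_num), integral_Icc_eq_integral_Ioc,
    ← RCLike.re_to_complex, ← integral_re]
  · refine setIntegral_congr_fun measurableSet_Ioc fun x ⟨hx1, hx₂⟩ ↦ ?_
    norm_cast
    rw [← Complex.ofReal_cpow, ← Complex.ofReal_cpow, RCLike.re_to_complex,
      Complex.re_mul_ofReal, Complex.ofReal_re]
    all_goals linarith
  · have := Complex.betaIntegral_convergent (u := a) (v := b) (by simpa) (by simpa)
    rwa [intervalIntegrable_iff_integrableOn_Ioc_of_le (by simp), IntegrableOn] at this

lemma integrable_of_integral_pos {α : Type*} [MeasurableSpace α] {μ : Measure α} {f : α → ℝ}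
    (h : 0 < ∫ x, f x ∂μ) : Integrable f μ := by
  by_contra hc
  rw [integral_undef hc] at h
  exact lt_irrefl _ h

lemma inner_int {u c : ℝ} (hu : 0 < u) (hc : 0 < c) (k : ℕ) :
    ∫ x : ℝ, x ^ (2 * k) * (if x ^ 2 ≤ u then (u - x ^ 2) ^ (c - 1) else 0) =
      u ^ ((k : ℝ) + c - 1 / 2) * eulerBeta (1 / 2 + k) c := by
  set h : ℝ → ℝ := fun y => if y ≤ u then y ^ ((k : ℝ) - 1 / 2) * (u - y) ^ (c - 1) else 0 with hh
  have e1 := integral_comp_abs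
    (f := fun x : ℝ => x ^ (2 * k) * (if x ^ 2 ≤ u then (u - x ^ 2) ^ (c - 1) else 0))
  simp only [sq_abs, pow_mul] at e1
  simp only [pow_mul]
  rw [e1]
  have e2 := integral_comp_rpow_Ioi_of_pos (g := h) (p := 2) (by norm_num)
  have e3 := integral_comp_mul_left_Ioi' h 0 hu
  rw [mul_zero] at e3
  have e4 : ∫ x in Set.Ioi (0 : ℝ), h (u * x) =
      u ^ ((k : ℝ) - 1 / 2 + (c - 1)) * eulerBeta (1 / 2 + k) c := by
    rw [← beta_int (by positivity) hc, integral_Icc_eq_integral_Ioc, ← integral_const_mul]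
    have : Set.Ioc (0 : ℝ) 1 = Set.Ioi 0 ∩ Set.Iic 1 := rfl
    rw [this, ← setIntegral_indicator measurableSet_Iic]
    refine setIntegral_congr_fun measurableSet_Ioi fun x hx => ?_
    have hx : 0 < x := hx
    simp only [hh, Set.indicator, Set.mem_Iic]
    have hiff : u * x ≤ u ↔ x ≤ 1 := by
      constructor
      · intro h; nlinarith
      · intro h; nlinarith
    simp only [hiff]
    split_ifs with h1
    · rw [show u - u * x = u * (1 - x) by ring, Real.mul_rpow hu.le hx.le,
        Real.mul_rpow hu.le (by linarith), Real.rpow_add hu,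
        show (1 / 2 + (k : ℝ) - 1) = (k : ℝ) - 1 / 2 by ring]
      ring
    · rfl
  have e5 : ∫ x in Set.Ioi (0 : ℝ), (2 * x ^ ((2 : ℝ) - 1)) • h (x ^ (2 : ℝ)) =
      2 * ∫ x in Set.Ioi (0 : ℝ), (x ^ 2) ^ k * (if x ^ 2 ≤ u then (u - x ^ 2) ^ (c - 1) else 0) := by
    rw [← integral_const_mul]
    refine setIntegral_congr_fun measurableSet_Ioi fun x hx => ?_
    have hx : 0 < x := hx
    simp only [hh, Real.rpow_two, smul_eq_mul]
    split_ifs with h1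
    · rw [show (2 : ℝ) - 1 = 1 by norm_num, Real.rpow_one, Real.rpow_sub (by positivity),
        Real.rpow_natCast, ← Real.sqrt_eq_rpow, Real.sqrt_sq hx.le]
      field_simp
    · simp
  rw [← e5, e2, ← e3, e4, smul_eq_mul, ← mul_assoc]
  congr 1
  rw [show (k : ℝ) + c - 1 / 2 = 1 + ((k : ℝ) - 1 / 2 + (c - 1)) by ring, Real.rpow_add hu 1,
    Real.rpow_one]

lemma gamma_prod {a : ℝ} (ha : 0 < a) (k : ℕ) :
    Real.Gamma (a + k) = Real.Gamma a * ∏ n ∈ Finset.range k, (a + n) := by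
  induction k with
  | zero => simp
  | succ k ih =>
    rw [Finset.prod_range_succ, ← mul_assoc, ← ih]
    push_cast
    rw [← add_assoc, Real.Gamma_add_one (by positivity)]
    ring

noncomputable def PP (a : ℝ) (k : ℕ) : ℝ := ∏ n ∈ Finset.range k, (a + n)

lemma PP_pos {a : ℝ} (ha : 0 < a) (k : ℕ) : 0 < PP a k :=
  Finset.prod_pos fun _ _ => by positivity

lemma beta_shift {a b : ℝ} (ha : 0 < a) (hb : 0 < b) (k : ℕ) :
    eulerBeta (a + k) b = eulerBeta a b * (PP a k / PP (a + b) k) := by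
  have h1 := Real.Gamma_pos_of_pos (add_pos ha hb)
  have h2 := PP_pos (add_pos ha hb) k
  unfold eulerBeta
  rw [show a + k + b = a + b + k by ring, gamma_prod ha, gamma_prod (add_pos ha hb)]
  change _ * PP a k * _ / (_ * PP (a + b) k) = _
  field_simp

lemma fact_prod {d : ℕ} (hd : 0 < d) (e k : ℕ) :
    ((d * k + e).factorial : ℝ) =
      e.factorial * ((d : ℝ) ^ d) ^ k * ∏ j ∈ Finset.range d, PP (((j : ℝ) + 1 + e) / d) k := by
  have hd' : (d : ℝ) ≠ 0 := by positivity
  induction k with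
  | zero => simp [PP]
  | succ k ih =>
    rw [show d * (k + 1) + e = (d * k + e) + d by ring, ← Nat.factorial_mul_ascFactorial]
    push_cast
    rw [ih, Nat.ascFactorial_eq_prod_range]
    have : ∀ j, PP (((j : ℝ) + 1 + e) / d) (k + 1) =
      PP (((j : ℝ) + 1 + e) / d) k * (((j : ℝ) + 1 + e) / d + k) := fun j => by
        unfold PP
        rw [Finset.prod_range_succ]
    simp only [this, Finset.prod_mul_distrib]
    have h3 : ((∏ i ∈ Finset.range d, (d * k + e + 1 + i) : ℕ) : ℝ) =
        (d : ℝ) ^ d * ∏ j ∈ Finset.range d, (((j : ℝ) + 1 + e) / d + k) := by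
      have : (d : ℝ) ^ d = ∏ j ∈ Finset.range d, (d : ℝ) := by simp
      rw [this, ← Finset.prod_mul_distrib]
      push_cast
      refine Finset.prod_congr rfl fun j _ => ?_
      field_simp
      ring
    rw [h3]
    ring

noncomputable def al (s : ℕ) (i : ℕ) : ℝ := ((i : ℝ) + 1) / ((s : ℝ) + 1)

noncomputable def be (s : ℕ) (i : ℕ) : ℝ :=
  if i = 0 then ((s : ℝ) - 1) / (2 * (s : ℝ) + 2) else ((i : ℝ) + 1) / ((s : ℝ) * ((s : ℝ) + 1))

lemma al_pos (s i : ℕ) : 0 < al s i := by unfold al; positivity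

lemma be_pos {s : ℕ} (hs : 2 ≤ s) (i : ℕ) : 0 < be s i := by
  have h : (2 : ℝ) ≤ s := by exact_mod_cast hs
  unfold be
  split_ifs
  · exact div_pos (by linarith) (by linarith)
  · positivity

lemma Fdens_eq (s : ℕ) (t : Fin s → ℝ) :
    Fdens s t = Cnorm s * ∏ i : Fin s, (t i ^ (al s i - 1) * (1 - t i) ^ (be s i - 1)) := by
  unfold Fdens al be
  congr 1
  refine Finset.prod_congr rfl fun i _ => ?_
  split_ifs with h
  · simp [h]
  · rfl

lemma Cnorm_eq {s : ℕ} (hs : 2 ≤ s) :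
    Cnorm s = 1 / ∏ i : Fin s, eulerBeta (al s i) (be s i) := by
  rw [Fin.prod_univ_eq_prod_range (fun i => eulerBeta (al s i) (be s i))]
  obtain ⟨r, rfl⟩ : ∃ r, s = r + 1 := ⟨s - 1, by omega⟩
  unfold Cnorm
  rw [Finset.prod_range_succ', mul_comm (∏ k ∈ Finset.range r, _)]
  congr 2
  · simp [al, be]
  · rw [show Finset.Icc 2 (r + 1) = Finset.Ico 2 (r + 2) by ext; simp; omega,
      Finset.prod_Ico_eq_prod_range]
    refine Finset.prod_congr rfl fun i _ => ?_
    simp only [al, be, Nat.add_eq_zero_iff, one_ne_zero, and_false, if_false]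
    push_cast
    congr 2 <;> ring

lemma restrict_cube (s : ℕ) : (volume : Measure (Fin s → ℝ)).restrict (cube s) =
    Measure.pi fun _ => (volume : Measure ℝ).restrict (Set.Icc 0 1) := by
  rw [cube, volume_pi, Measure.restrict_pi_pi]

lemma cube_moment {s : ℕ} (hs : 2 ≤ s) (k : ℕ) :
    ∫ t in cube s, tauProd t ^ k * Fdens s t =
      ∏ i : Fin s, (PP (al s i) k / PP (al s i + be s i) k) := by
  have hpos : ∀ i : Fin s, 0 < eulerBeta (al s i) (be s i) :=
    fun i => eulerBeta_pos' (al_pos s i) (be_pos hs i)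
  have h1 : ∀ i : Fin s, ∫ x in Set.Icc (0 : ℝ) 1,
      x ^ k * (x ^ (al s i - 1) * (1 - x) ^ (be s i - 1)) =
        eulerBeta (al s i) (be s i) * (PP (al s i) k / PP (al s i + be s i) k) := by
    intro i
    rw [← beta_shift (al_pos s i) (be_pos hs i), ← beta_int (by have := al_pos s i; positivity)
      (be_pos hs i), integral_Icc_eq_integral_Ioc, integral_Icc_eq_integral_Ioc]
    refine setIntegral_congr_fun measurableSet_Ioc fun x hx => ?_
    have hx : 0 < x := hx.1
    rw [show al s i + k - 1 = k + (al s i - 1) by ring, Real.rpow_add hx, Real.rpow_natCast]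
    ring
  have h2 : ∀ t : Fin s → ℝ, tauProd t ^ k * Fdens s t = Cnorm s * ∏ i : Fin s,
      (t i ^ k * (t i ^ (al s i - 1) * (1 - t i) ^ (be s i - 1))) := by
    intro t
    rw [Finset.prod_mul_distrib, Fdens_eq, tauProd, Finset.prod_pow]
    ring
  simp_rw [h2]
  rw [integral_const_mul, restrict_cube, integral_fintype_prod_eq_prod
    (f := fun (i : Fin s) (x : ℝ) => x ^ k * (x ^ (al s i - 1) * (1 - x) ^ (be s i - 1)))]
  simp_rw [h1]
  rw [Finset.prod_mul_distrib, Cnorm_eq hs, ← mul_assoc, one_div,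
    inv_mul_cancel₀ (Finset.prod_pos fun i _ => hpos i).ne', one_mul]

lemma cube_moment_pos {s : ℕ} (hs : 2 ≤ s) (k : ℕ) :
    0 < ∫ t in cube s, tauProd t ^ k * Fdens s t := by
  rw [cube_moment hs]
  exact Finset.prod_pos fun i _ => div_pos (PP_pos (al_pos s i) k)
    (PP_pos (add_pos (al_pos s i) (be_pos hs i)) k)

lemma PP_one (k : ℕ) : PP 1 k = k.factorial := by
  unfold PP
  rw [← Finset.prod_range_add_one_eq_factorial]
  push_cast
  exact Finset.prod_congr rfl fun i _ => by ring

lemma final_alg {s : ℕ} (hs : 2 ≤ s) (k : ℕ) :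
    Kc s ^ k * (PP (1 / 2) k / PP (1 / 2 + (1 / 2 + 1 / (s : ℝ))) k) *
      ∏ i : Fin s, (PP (al s i) k / PP (al s i + be s i) k) =
    (1 / ((s : ℝ) * k + 1)) * (((s + 1) * k).choose k) := by
  have hs0 : (0 : ℝ) < s := by positivity
  rw [Fin.prod_univ_eq_prod_range (fun i => PP (al s i) k / PP (al s i + be s i) k),
    Finset.prod_div_distrib]
  have f1 := fact_prod (d := s + 1) (by omega) 0 k
  have f2 := fact_prod (d := s) (by omega) 1 k
  rw [Finset.prod_range_succ] at f1
  have g1 : ((s : ℝ) + 1 + (0 : ℕ)) / ((s + 1 : ℕ) : ℝ) = 1 := by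
    push_cast; field_simp; try ring
  rw [g1, PP_one] at f1
  have g2 : ∏ j ∈ Finset.range s, PP (al s j) k =
      ∏ j ∈ Finset.range s, PP (((j : ℝ) + 1 + (0 : ℕ)) / ((s + 1 : ℕ) : ℝ)) k :=
    Finset.prod_congr rfl fun i _ => by simp [al]
  rw [← g2] at f1
  have g3 : (∏ j ∈ Finset.range s, PP (al s j + be s j) k) * PP (1 / 2 + (1 / 2 + 1 / (s : ℝ))) k =
      PP (1 / 2) k * ∏ j ∈ Finset.range s, PP (((j : ℝ) + 1 + (1 : ℕ)) / s) k := by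
    obtain ⟨r, rfl⟩ : ∃ r, s = r + 1 := ⟨s - 1, by omega⟩
    rw [Finset.prod_range_succ', Finset.prod_range_succ]
    have a1 : al (r + 1) 0 + be (r + 1) 0 = 1 / 2 := by
      simp only [al, be, if_true]; push_cast; field_simp; try ring
    have a2 : ∀ j, al (r + 1) (j + 1) + be (r + 1) (j + 1) =
        ((j : ℝ) + 1 + (1 : ℕ)) / ((r + 1 : ℕ) : ℝ) := by
      intro j
      simp only [al, be, Nat.add_eq_zero_iff, one_ne_zero, and_false, if_false]
      push_cast; field_simp; try ring
    have a3 : 1 / 2 + (1 / 2 + 1 / ((r + 1 : ℕ) : ℝ)) =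
        ((r : ℝ) + 1 + (1 : ℕ)) / ((r + 1 : ℕ) : ℝ) := by
      push_cast; field_simp; try ring
    simp only [a1, a2, a3]
    ring
  have c1 : (((s + 1) * k).choose k : ℝ) * (k.factorial * (s * k).factorial) =
      ((s + 1) * k).factorial := by
    have := Nat.choose_mul_factorial_mul_factorial (n := (s + 1) * k) (k := k) (by nlinarith)
    rw [show (s + 1) * k - k = s * k by rw [add_mul, one_mul, Nat.add_sub_cancel]] at this
    rw [← this]; push_cast; ring
  have c2 : ((s * k + 1).factorial : ℝ) = (s * k + 1) * (s * k).factorial := by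
    rw [Nat.factorial_succ]; push_cast; ring
  rw [c2] at f2
  rw [add_zero, ← c1] at f1
  have p1 : PP (1 / 2) k ≠ 0 := (PP_pos (by norm_num) k).ne'
  have p2 : PP (1 / 2 + (1 / 2 + 1 / (s : ℝ))) k ≠ 0 := (PP_pos (by positivity) k).ne'
  have p3 : (∏ j ∈ Finset.range s, PP (al s j + be s j) k) ≠ 0 :=
    (Finset.prod_pos fun i _ => PP_pos (add_pos (al_pos s i) (be_pos hs i)) k).ne'
  have p4 : (k.factorial : ℝ) ≠ 0 := by positivity
  have p5 : ((s * k).factorial : ℝ) ≠ 0 := by positivity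
  have p6 : (s : ℝ) * k + 1 ≠ 0 := by positivity
  have p7 : ((s : ℝ) ^ s) ^ k ≠ 0 := by positivity
  unfold Kc
  rw [div_pow]
  simp only [Nat.factorial_zero, Nat.factorial_one, Nat.cast_one, one_mul, Nat.cast_add] at f1 f2
  set C : ℝ := (((s + 1) * k).choose k : ℝ)
  set A := ∏ j ∈ Finset.range s, PP (al s j) k
  set D := ∏ j ∈ Finset.range s, PP (al s j + be s j) k
  set E := PP (1 / 2 + (1 / 2 + 1 / (s : ℝ))) k
  set H := PP (1 / 2) k
  set L := ((s : ℝ) ^ s) ^ k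
  set M := (((s : ℝ) + 1) ^ (s + 1)) ^ k
  set W := ((s * k).factorial : ℝ)
  have f1' : C * W = M * A := by
    apply mul_left_cancel₀ p4; linear_combination f1
  simp only [Nat.cast_one] at g3
  set N := ∏ j ∈ Finset.range s, PP (((j : ℝ) + 1 + 1) / s) k
  rw [div_mul_div_comm, div_mul_div_comm, one_div, inv_mul_eq_div, div_eq_div_iff (by positivity) p6]
  apply mul_right_cancel₀ p5
  linear_combination M * H * A * f2 - C * L * W * g3 - L * H * N * f1'

noncomputable def GG (s : ℕ) (x : ℝ) (t : Fin s → ℝ) : ℝ :=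
  if x ^ 2 ≤ tauProd t * Kc s then
    (tauProd t * Kc s - x ^ 2) ^ (1 / (s : ℝ) - 1 / 2) *
      (tauProd t * Kc s) ^ (-(1 : ℝ) / (s : ℝ)) * Fdens s t
  else 0

lemma sigmaDens_eq (s : ℕ) (x : ℝ) : sigmaDens s x =
    (1 / eulerBeta (1 / 2) (1 / 2 + 1 / (s : ℝ))) * ∫ t in cube s, GG s x t := rfl

lemma Kc_pos {s : ℕ} (hs : 2 ≤ s) : 0 < Kc s := by
  have : 0 < s := by omega
  unfold Kc; positivity

lemma measurable_tauProd (s : ℕ) : Measurable (fun t : Fin s → ℝ => tauProd t) := by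
  unfold tauProd; fun_prop

lemma measurable_Fdens (s : ℕ) : Measurable (fun t : Fin s → ℝ => Fdens s t) := by
  simp_rw [Fdens_eq]
  fun_prop

lemma measurable_GG (s : ℕ) : Measurable (fun p : ℝ × (Fin s → ℝ) => GG s p.1 p.2) := by
  have h1 : Measurable (fun p : ℝ × (Fin s → ℝ) => tauProd p.2) :=
    (measurable_tauProd s).comp measurable_snd
  have h2 : Measurable (fun p : ℝ × (Fin s → ℝ) => Fdens s p.2) :=
    (measurable_Fdens s).comp measurable_snd
  unfold GG
  refine Measurable.ite (measurableSet_le (by fun_prop) (by fun_prop)) (by fun_prop) (by fun_prop)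

lemma ae_cube (s : ℕ) : ∀ᵐ t : Fin s → ℝ ∂(volume.restrict (cube s)),
    ∀ i, 0 < t i ∧ t i < 1 := by
  have h : cube s = Set.Icc (fun _ => 0) (fun _ => 1) := by
    rw [cube, Set.pi_univ_Icc]
  have h2 : (Set.univ.pi fun _ : Fin s => Set.Ioo (0 : ℝ) 1) =ᵐ[volume] cube s := by
    rw [h]; exact Measure.univ_pi_Ioo_ae_eq_Icc
  rw [← Measure.restrict_congr_set h2]
  filter_upwards [ae_restrict_mem (MeasurableSet.univ_pi fun _ => measurableSet_Ioo)] with t ht i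
  exact ht i (Set.mem_univ i)

lemma Cnorm_pos {s : ℕ} (hs : 2 ≤ s) : 0 < Cnorm s := by
  rw [Cnorm_eq hs]
  exact one_div_pos.2 (Finset.prod_pos fun i _ => eulerBeta_pos' (al_pos s i) (be_pos hs i))

lemma Fdens_pos {s : ℕ} (hs : 2 ≤ s) {t : Fin s → ℝ} (ht : ∀ i, 0 < t i ∧ t i < 1) :
    0 < Fdens s t := by
  rw [Fdens_eq]
  exact mul_pos (Cnorm_pos hs) (Finset.prod_pos fun i _ => mul_pos
    (Real.rpow_pos_of_pos (ht i).1 _) (Real.rpow_pos_of_pos (by linarith [(ht i).2]) _))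

lemma GG_nonneg {s : ℕ} (hs : 2 ≤ s) {t : Fin s → ℝ} (ht : ∀ i, 0 < t i ∧ t i < 1) (x : ℝ) :
    0 ≤ GG s x t := by
  have h1 := Fdens_pos hs ht
  have h2 : 0 < tauProd t := Finset.prod_pos fun i _ => (ht i).1
  have h3 := Kc_pos hs
  unfold GG
  split_ifs with h
  · have : 0 ≤ tauProd t * Kc s - x ^ 2 := by linarith
    positivity
  · exact le_rfl

lemma GG_moment {s : ℕ} (hs : 2 ≤ s) {t : Fin s → ℝ} (ht : ∀ i, 0 < t i ∧ t i < 1) (k : ℕ) :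
    ∫ x : ℝ, x ^ (2 * k) * GG s x t =
      (Kc s ^ k * eulerBeta (1 / 2 + k) (1 / 2 + 1 / (s : ℝ))) * (tauProd t ^ k * Fdens s t) := by
  have h2 : 0 < tauProd t := Finset.prod_pos fun i _ => (ht i).1
  have h3 := Kc_pos hs
  have hu : 0 < tauProd t * Kc s := mul_pos h2 h3
  have hs0 : (0 : ℝ) < s := by positivity
  have h := inner_int (c := 1 / 2 + 1 / (s : ℝ)) hu (by positivity) k
  have h4 : ∀ x : ℝ, x ^ (2 * k) * GG s x t =
      (x ^ (2 * k) * (if x ^ 2 ≤ tauProd t * Kc s then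
        (tauProd t * Kc s - x ^ 2) ^ (1 / 2 + 1 / (s : ℝ) - 1) else 0)) *
      ((tauProd t * Kc s) ^ (-(1 : ℝ) / (s : ℝ)) * Fdens s t) := by
    intro x
    unfold GG
    rw [show 1 / 2 + 1 / (s : ℝ) - 1 = 1 / (s : ℝ) - 1 / 2 by ring]
    split_ifs
    · ring
    · ring
  simp_rw [h4]
  rw [integral_mul_const, h, show (k : ℝ) + (1 / 2 + 1 / (s : ℝ)) - 1 / 2 = k + 1 / (s : ℝ) by ring,
    Real.rpow_add hu, Real.rpow_natCast, neg_div, Real.rpow_neg hu.le]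
  have : (tauProd t * Kc s) ^ (1 / (s : ℝ)) ≠ 0 := (Real.rpow_pos_of_pos hu _).ne'
  rw [mul_pow]
  field_simp

lemma GG_integrable {s : ℕ} (hs : 2 ≤ s) (k : ℕ) :
    Integrable (fun p : ℝ × (Fin s → ℝ) => p.1 ^ (2 * k) * GG s p.1 p.2)
      ((volume : Measure ℝ).prod ((volume : Measure (Fin s → ℝ)).restrict (cube s))) := by
  have hm := measurable_GG s
  have hs0 : (0 : ℝ) < s := by positivity
  rw [integrable_prod_iff' (by
    exact ((measurable_fst.pow_const _).mul hm).aestronglyMeasurable)]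
  constructor
  · filter_upwards [ae_cube s] with t ht
    apply integrable_of_integral_pos
    rw [GG_moment hs ht]
    have h1 := Fdens_pos hs ht
    have h2 : 0 < tauProd t := Finset.prod_pos fun i _ => (ht i).1
    have h3 := Kc_pos hs
    have h4 : 0 < eulerBeta (1 / 2 + k) (1 / 2 + 1 / (s : ℝ)) :=
      eulerBeta_pos' (by positivity) (by positivity)
    positivity
  · have := (integrable_of_integral_pos (cube_moment_pos hs k)).const_mul
      (Kc s ^ k * eulerBeta (1 / 2 + k) (1 / 2 + 1 / (s : ℝ)))
    refine this.congr ?_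
    filter_upwards [ae_cube s] with t ht
    rw [← GG_moment hs ht]
    refine integral_congr_ae (Filter.Eventually.of_forall fun x => ?_)
    simp only
    rw [Real.norm_of_nonneg]
    exact mul_nonneg (by rw [pow_mul]; positivity) (GG_nonneg hs ht x)

lemma sigma_moment {s : ℕ} (hs : 2 ≤ s) (k : ℕ) :
    ∫ x : ℝ, x ^ (2 * k) * sigmaDens s x =
      (1 / ((s : ℝ) * k + 1)) * (((s + 1) * k).choose k) := by
  have hs0 : (0 : ℝ) < s := by positivity
  have hB : 0 < eulerBeta (1 / 2) (1 / 2 + 1 / (s : ℝ)) :=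
    eulerBeta_pos' (by positivity) (by positivity)
  have h1 : ∀ x : ℝ, x ^ (2 * k) * sigmaDens s x =
      (1 / eulerBeta (1 / 2) (1 / 2 + 1 / (s : ℝ))) * ∫ t in cube s, x ^ (2 * k) * GG s x t := by
    intro x
    rw [sigmaDens_eq, integral_const_mul]; ring
  simp_rw [h1]
  rw [integral_const_mul, integral_integral_swap (f := fun x t => x ^ (2 * k) * GG s x t)
    (GG_integrable hs k), ← final_alg hs k, ← cube_moment hs k]
  have h2 : ∫ t in cube s, (∫ x : ℝ, x ^ (2 * k) * GG s x t) =
      ∫ t in cube s, (Kc s ^ k * eulerBeta (1 / 2 + k) (1 / 2 + 1 / (s : ℝ))) *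
        (tauProd t ^ k * Fdens s t) := by
    refine integral_congr_ae ?_
    filter_upwards [ae_cube s] with t ht
    exact GG_moment hs ht k
  rw [h2, integral_const_mul, beta_shift (by norm_num) (by positivity)]
  generalize (∫ t in cube s, tauProd t ^ k * Fdens s t) = J
  generalize PP (1 / 2 + (1 / 2 + 1 / (s : ℝ))) k = Q
  generalize eulerBeta (1 / 2) (1 / 2 + 1 / (s : ℝ)) = R at hB
  field_simp

lemma sigma_integrable {s : ℕ} (hs : 2 ≤ s) : Integrable (sigmaDens s) := by
  have := (GG_integrable hs 0).integral_prod_left.const_mul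
    (1 / eulerBeta (1 / 2) (1 / 2 + 1 / (s : ℝ)))
  refine this.congr (Filter.Eventually.of_forall fun x => ?_)
  simp [sigmaDens_eq]

lemma sigma_neg (s : ℕ) (x : ℝ) : sigmaDens s (-x) = sigmaDens s x := by
  simp [sigmaDens]

lemma sigma_zero {s : ℕ} (hs : 2 ≤ s) {x : ℝ} (hx : Kc s < x ^ 2) : sigmaDens s x = 0 := by
  rw [sigmaDens_eq]
  have : ∫ t in cube s, GG s x t = 0 := by
    apply integral_eq_zero_of_ae
    filter_upwards [ae_cube s] with t ht
    have h2 : tauProd t ≤ 1 := Finset.prod_le_one (fun i _ => (ht i).1.le) (fun i _ => (ht i).2.le)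
    have h3 := Kc_pos hs
    unfold GG
    rw [if_neg]
    · rfl
    · nlinarith
  rw [this, mul_zero]

lemma sigma_hasSum {s : ℕ} (hs : 2 ≤ s) (ξ : ℝ) :
    HasSum (fun k : ℕ => (-ξ ^ 2) ^ k * ((1 / ((s : ℝ) * k + 1)) * (((s + 1) * k).choose k)) /
        ((2 * k).factorial : ℝ)) (∫ x : ℝ, Real.cos (ξ * x) * sigmaDens s x) := by
  have hint := sigma_integrable hs
  have hK := Kc_pos hs
  have hsum : Summable (fun k : ℕ => (ξ ^ 2 * Kc s) ^ k / ((2 * k).factorial : ℝ)) := by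
    refine Summable.of_nonneg_of_le (fun k => by positivity) (fun k => ?_)
      (Real.summable_pow_div_factorial (ξ ^ 2 * Kc s))
    gcongr
    omega
  have key := hasSum_integral_of_dominated_convergence (μ := (volume : Measure ℝ))
    (F := fun (k : ℕ) x => (-1) ^ k * (ξ * x) ^ (2 * k) / ((2 * k).factorial : ℝ) * sigmaDens s x)
    (f := fun x => Real.cos (ξ * x) * sigmaDens s x)
    (fun k x => (ξ ^ 2 * Kc s) ^ k / ((2 * k).factorial : ℝ) * |sigmaDens s x|)
    (fun k => by
      exact (Continuous.aestronglyMeasurable (by fun_prop)).mul hint.aestronglyMeasurable)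
    (fun k => Filter.Eventually.of_forall fun x => by
      by_cases hx : Kc s < x ^ 2
      · simp [sigma_zero hs hx]
      · push Not at hx
        rw [norm_mul, norm_div, norm_mul, norm_pow, norm_neg, norm_one, one_pow, one_mul,
          Real.norm_eq_abs, Real.norm_eq_abs, Real.norm_eq_abs, pow_mul, abs_pow, Nat.abs_cast,
          abs_of_nonneg (sq_nonneg _), mul_pow]
        gcongr)
    (Filter.Eventually.of_forall fun x => hsum.mul_right _)
    (by
      simp_rw [tsum_mul_right]
      exact hint.abs.const_mul _)
    (Filter.Eventually.of_forall fun x => (Real.hasSum_cos (ξ * x)).mul_right _)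
  convert! key using 2 with k
  have : ∀ x : ℝ, (-1) ^ k * (ξ * x) ^ (2 * k) / ((2 * k).factorial : ℝ) * sigmaDens s x =
      ((-ξ ^ 2) ^ k / ((2 * k).factorial : ℝ)) * (x ^ (2 * k) * sigmaDens s x) := by
    intro x
    rw [mul_pow, neg_pow (ξ ^ 2), ← pow_mul]
    ring
  simp_rw [this]
  rw [integral_const_mul, sigma_moment hs]
  ring

lemma char_eq {s : ℕ} (hs : 2 ≤ s) (ξ : ℝ) :
    (∫ x in -Real.sqrt (Kc s)..Real.sqrt (Kc s),
        Complex.exp (Complex.I * (ξ : ℂ) * (x : ℂ)) * (sigmaDens s x : ℂ)) =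
      ((∫ x : ℝ, Real.cos (ξ * x) * sigmaDens s x : ℝ) : ℂ) := by
  have hint := sigma_integrable hs
  have hK := Kc_pos hs
  have e1 : (∫ x in -Real.sqrt (Kc s)..Real.sqrt (Kc s),
        Complex.exp (Complex.I * (ξ : ℂ) * (x : ℂ)) * (sigmaDens s x : ℂ)) =
      ∫ x : ℝ, Complex.exp (Complex.I * (ξ : ℂ) * (x : ℂ)) * (sigmaDens s x : ℂ) := by
    rw [intervalIntegral.integral_of_le (by linarith [Real.sqrt_nonneg (Kc s)]),
      ← integral_Icc_eq_integral_Ioc]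
    apply setIntegral_eq_integral_of_forall_compl_eq_zero
    intro x hx
    rw [sigma_zero hs]
    · simp
    · by_contra hc
      push Not at hc
      exact hx (abs_le.1 (Real.abs_le_sqrt hc))
  have i1 : Integrable (fun x : ℝ => Real.cos (ξ * x) * sigmaDens s x) :=
    hint.bdd_mul (c := 1) (Continuous.aestronglyMeasurable (by fun_prop))
      (Filter.Eventually.of_forall fun x => Real.abs_cos_le_one _)
  have i2 : Integrable (fun x : ℝ => Real.sin (ξ * x) * sigmaDens s x) :=
    hint.bdd_mul (c := 1) (Continuous.aestronglyMeasurable (by fun_prop))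
      (Filter.Eventually.of_forall fun x => Real.abs_sin_le_one _)
  have z : ∫ x : ℝ, Real.sin (ξ * x) * sigmaDens s x = 0 := by
    have := integral_neg_eq_self (fun x : ℝ => Real.sin (ξ * x) * sigmaDens s x) volume
    simp only [sigma_neg, mul_neg, Real.sin_neg, neg_mul] at this
    rw [integral_neg] at this
    linarith
  have e2 : ∀ x : ℝ, Complex.exp (Complex.I * (ξ : ℂ) * (x : ℂ)) * (sigmaDens s x : ℂ) =
      ((Real.cos (ξ * x) * sigmaDens s x : ℝ) : ℂ) +
        ((Real.sin (ξ * x) * sigmaDens s x : ℝ) : ℂ) * Complex.I := by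
    intro x
    rw [show Complex.I * (ξ : ℂ) * (x : ℂ) = ((ξ * x : ℝ) : ℂ) * Complex.I by push_cast; ring,
      Complex.exp_mul_I]
    push_cast
    ring
  rw [e1]
  simp_rw [e2]
  rw [integral_add i1.ofReal (i2.ofReal.mul_const _), integral_mul_const,
    integral_complex_ofReal, integral_complex_ofReal, z]
  simp

/-- For every integer `s ≥ 2` and every real `ξ`, the characteristic function
of the density `σ_s` is given by the everywhere absolutely convergent series
`∫_{−√K}^{√K} e^{iξx} σ_s(x) dx = ∑_{k=0}^∞ (−ξ²)^k m_k/(2k)!` where `m_k` is the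
Fuss–Catalan number. -/
theorem charFun_sigmaDens (s : ℕ) (hs : 2 ≤ s) (ξ : ℝ) :
    Summable (fun k : ℕ =>
      |(-ξ ^ 2) ^ k * ((1 / ((s : ℝ) * k + 1)) * (((s + 1) * k).choose k)) /
        ((2 * k).factorial : ℝ)|) ∧
    (∫ x in -Real.sqrt (Kc s)..Real.sqrt (Kc s),
        Complex.exp (Complex.I * (ξ : ℂ) * (x : ℂ)) * (sigmaDens s x : ℂ)) =
      ∑' k : ℕ,
        (((-ξ ^ 2) ^ k * ((1 / ((s : ℝ) * k + 1)) * (((s + 1) * k).choose k)) /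
          ((2 * k).factorial : ℝ) : ℝ) : ℂ) := by
  have h := sigma_hasSum hs ξ
  refine ⟨h.summable.abs, ?_⟩
  rw [char_eq hs, ← h.tsum_eq, Complex.ofReal_tsum]
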